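/- Let P be an r-differential poset and n ≥ 0. Set m = max{Δp_j : 0 ≤ j ≤ n} where Δp_j := p_j − p_{j−1}, and for 1 ≤ i ≤ m set a_i(x) = ∏_{1 ≤ j ≤ n+1, Δp_{n+1−j} ≥ m−i+1} (x − rj). Then the Smith normal form over ℚ[x] of the matrix x·I_{p_n} − [DU_n] is diag(1, ..., 1, a_1(x), a_2(x), ..., a_m(x)); equivalently, the ℚ[x]-module ℚ^{p_n} with x acting as DU_n decomposes as a direct sum of m cyclic ℚ[x]-submodules V_1, ..., V_m with annihilators (a_1(x)), ..., (a_m(x)), and a_1(x) | a_2(x) | ... | a_m(x). -/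

import Mathlib

open Polynomial

/-- A rectangular matrix over a commutative ring has Smith normal form: there are
invertible matrices `P`, `Q` such that `P * A * Q` is diagonal with diagonal entries
forming a divisibility chain. -/
def Matrix.HasSNF {R : Type*} [CommRing R] {m n : ℕ} (A : Matrix (Fin m) (Fin n) R) : Prop :=
  ∃ (P : Matrix (Fin m) (Fin m) R) (Q : Matrix (Fin n) (Fin n) R),
    IsUnit P ∧ IsUnit Q ∧
    (∀ (i : Fin m) (j : Fin n), (i : ℕ) ≠ (j : ℕ) → (P * A * Q) i j = 0) ∧
    (∀ (i : ℕ) (h₁ : i + 1 < m) (h₂ : i + 1 < n),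
      (P * A * Q) ⟨i, Nat.lt_of_succ_lt h₁⟩ ⟨i, Nat.lt_of_succ_lt h₂⟩ ∣
        (P * A * Q) ⟨i + 1, h₁⟩ ⟨i + 1, h₂⟩)

/-- SNF for matrices with arbitrary finite index types. -/
def Matrix.HasSNF' {ι κ R : Type*} [Fintype ι] [Fintype κ] [CommRing R]
    (A : Matrix ι κ R) : Prop :=
  ∃ (eι : ι ≃ Fin (Fintype.card ι)) (eκ : κ ≃ Fin (Fintype.card κ)),
    Matrix.HasSNF (Matrix.reindex eι eκ A)
/-- An endomorphism `φ` of a `ℤ`-module `M` (equivalently, the `ℤ[x]`-module `(M, φ)` where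
`x` acts as `φ`) has rational canonical form over `ℤ`: `M` is an internal direct sum of
cyclic `ℤ[x]`-submodules whose annihilators are generated by monic non-constant polynomials
`a_1 ∣ a_2 ∣ ... ∣ a_k`. -/
def Module.End.HasRCF {M : Type*} [AddCommGroup M] [Module ℤ M] (φ : Module.End ℤ M) : Prop :=
  ∃ (k : ℕ) (V : Fin k → Submodule ℤ[X] (Module.AEval' φ)) (a : Fin k → ℤ[X]),
    (∀ i, (a i).Monic) ∧ (∀ i, 0 < (a i).natDegree) ∧
    (∀ i j : Fin k, i ≤ j → a i ∣ a j) ∧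
    (∀ i, ∃ v : Module.AEval' φ, V i = Submodule.span ℤ[X] {v}) ∧
    (∀ i, (V i).annihilator = Ideal.span {a i}) ∧
    DirectSum.IsInternal V
/-- An `r`-differential poset. -/
structure DiffPoset (r : ℕ) where
  P : Type
  [po : PartialOrder P]
  locallyFinite : ∀ x y : P, (Set.Icc x y).Finite
  rk : P → ℕ
  fiberFinite : ∀ n : ℕ, {x : P | rk x = n}.Finite
  bot : P
  bot_le : ∀ x : P, bot ≤ x
  rk_bot : rk bot = 0
  rk_covBy : ∀ {x y : P}, x ⋖ y → rk y = rk x + 1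
  d2 : ∀ {x y : P}, x ≠ y →
      {z : P | z ⋖ x ∧ z ⋖ y}.ncard = {z : P | x ⋖ z ∧ y ⋖ z}.ncard
  d3 : ∀ x : P, {z : P | x ⋖ z}.ncard = {z : P | z ⋖ x}.ncard + r

attribute [instance] DiffPoset.po

namespace DiffPoset

variable {r : ℕ} (D : DiffPoset r)

/-- The `n`-th rank `P_n` of the poset. -/
abbrev level (n : ℕ) : Type := {x : D.P // D.rk x = n}

noncomputable instance (n : ℕ) : Fintype (D.level n) := (D.fiberFinite n).fintype

noncomputable instance (n : ℕ) : DecidableEq (D.level n) := Classical.decEq _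

noncomputable instance (x y : D.P) : Decidable (x ⋖ y) := Classical.dec _

/-- The rank size `p_n`. -/
noncomputable def p (n : ℕ) : ℕ := Fintype.card (D.level n)

/-- The matrix of the up map `U_n` in the standard basis. -/
noncomputable def upMatrix (R : Type*) [CommRing R] (n : ℕ) :
    Matrix (D.level (n + 1)) (D.level n) R :=
  fun y x => if (x : D.P) ⋖ (y : D.P) then 1 else 0

/-- The matrix of the down map `D_{n+1}` in the standard basis. -/
noncomputable def downMatrix (R : Type*) [CommRing R] (n : ℕ) :
    Matrix (D.level n) (D.level (n + 1)) R :=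
  fun y x => if (y : D.P) ⋖ (x : D.P) then 1 else 0

/-- The up map `U_n : RP_n → RP_{n+1}`. -/
noncomputable def up (R : Type*) [CommRing R] (n : ℕ) :
    (D.level n → R) →ₗ[R] (D.level (n + 1) → R) :=
  (D.upMatrix R n).mulVecLin

/-- The down map `D_{n+1} : RP_{n+1} → RP_n`. -/
noncomputable def down (R : Type*) [CommRing R] (n : ℕ) :
    (D.level (n + 1) → R) →ₗ[R] (D.level n → R) :=
  (D.downMatrix R n).mulVecLin

/-- The operator `DU_n = D_{n+1} ∘ U_n`. -/
noncomputable def du (R : Type*) [CommRing R] (n : ℕ) :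
    Module.End R (D.level n → R) :=
  (D.down R n) ∘ₗ (D.up R n)

/-- The matrix `[DU_n]` in the standard basis. -/
noncomputable def duMatrix (R : Type*) [CommRing R] (n : ℕ) :
    Matrix (D.level n) (D.level n) R :=
  D.downMatrix R n * D.upMatrix R n

/-- The operator `UD_n = U_{n-1} ∘ D_n` (zero for `n = 0`). -/
noncomputable def ud (R : Type*) [CommRing R] : (n : ℕ) → Module.End R (D.level n → R)
  | 0 => 0
  | (n + 1) => (D.up R n) ∘ₗ (D.down R n)

/-- The matrix `[UD_n]` in the standard basis (zero for `n = 0`). -/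
noncomputable def udMatrix (R : Type*) [CommRing R] :
    (n : ℕ) → Matrix (D.level n) (D.level n) R
  | 0 => 0
  | (n + 1) => D.upMatrix R n * D.downMatrix R n

/-- The rank size difference `Δp_n = p_n - p_{n-1}` (with `p_{-1} = 0`), as an integer. -/
noncomputable def dp : ℕ → ℤ
  | 0 => (D.p 0 : ℤ)
  | (n + 1) => (D.p (n + 1) : ℤ) - (D.p n : ℤ)

/-- The rank size difference `Δp_n = p_n - p_{n-1}` (with `p_{-1} = 0`), as a natural number. -/
noncomputable def dpN : ℕ → ℕ
  | 0 => D.p 0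
  | (n + 1) => D.p (n + 1) - D.p n

end DiffPoset

namespace DiffPoset

variable {r : ℕ} (D : DiffPoset r)

lemma eq_bot_of_rk_eq_zero {x : D.P} (hx : D.rk x = 0) : x = D.bot := by
  by_contra hne
  have hlt : D.bot < x := lt_of_le_of_ne (D.bot_le x) (Ne.symm hne)
  have hfin : (Set.Ico D.bot x).Finite := (D.locallyFinite D.bot x).subset Set.Ico_subset_Icc_self
  obtain ⟨z, hz⟩ := hfin.exists_maximal ⟨D.bot, le_rfl, hlt⟩
  have hcov : z ⋖ x := ⟨hz.prop.2, fun y hzy hyx =>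
    hzy.not_ge (hz.le_of_ge ⟨D.bot_le y, hyx⟩ hzy.le)⟩
  have := D.rk_covBy hcov
  omega

instance : Unique (D.level 0) where
  default := ⟨D.bot, D.rk_bot⟩
  uniq x := Subtype.ext (D.eq_bot_of_rk_eq_zero x.2)

lemma sum_level_ite (n : ℕ) (q : D.P → Prop) [DecidablePred q] (hq : ∀ z, q z → D.rk z = n) :
    ∑ z : D.level n, (if q z then (1 : ℚ) else 0) = ({z | q z}.ncard : ℚ) := by
  rw [Finset.sum_boole]
  congr 1
  rw [← Set.ncard_coe_finset, ← Set.ncard_image_of_injective _ Subtype.val_injective]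
  congr 1
  ext z
  simpa using fun h => hq z h

lemma duMatrix_apply (n : ℕ) (x y : D.level n) :
    D.duMatrix ℚ n x y = ({z | (x : D.P) ⋖ z ∧ (y : D.P) ⋖ z}.ncard : ℚ) := by
  classical
  rw [← D.sum_level_ite (n + 1) _ fun z hz => by rw [D.rk_covBy hz.1, x.2]]
  simp [duMatrix, Matrix.mul_apply, downMatrix, upMatrix, ← ite_and, and_comm]

lemma upMatrix_mul_downMatrix_apply (n : ℕ) (x y : D.level (n + 1)) :
    (D.upMatrix ℚ n * D.downMatrix ℚ n) x y =
      ({z | z ⋖ (x : D.P) ∧ z ⋖ (y : D.P)}.ncard : ℚ) := by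
  classical
  rw [← D.sum_level_ite n _ fun z hz => by have := D.rk_covBy hz.1; have := x.2; omega]
  simp [Matrix.mul_apply, downMatrix, upMatrix, ← ite_and, and_comm]

lemma duMatrix_zero : D.duMatrix ℚ 0 = (r : ℚ) • 1 := by
  ext x y
  obtain rfl := Subsingleton.elim y x
  have hx : (y : D.P) = D.bot := D.eq_bot_of_rk_eq_zero y.2
  have hempty : {z | z ⋖ (y : D.P)} = ∅ := by
    ext z
    simpa [hx] using fun h : z ⋖ D.bot => h.lt.not_ge (D.bot_le z)
  rw [duMatrix_apply]
  simp [D.d3, hempty]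

lemma duMatrix_succ (n : ℕ) :
    D.duMatrix ℚ (n + 1) = D.upMatrix ℚ n * D.downMatrix ℚ n + (r : ℚ) • 1 := by
  ext x y
  rw [Matrix.add_apply, duMatrix_apply, upMatrix_mul_downMatrix_apply]
  by_cases hxy : x = y
  · subst hxy
    simp [D.d3]
  · simp [hxy, D.d2 (Subtype.coe_injective.ne hxy)]

lemma du_eq_mulVecLin (n : ℕ) : D.du ℚ n = (D.duMatrix ℚ n).mulVecLin := by
  rw [du, down, up, duMatrix, Matrix.mulVecLin_mul]

lemma du_zero_apply (v : D.level 0 → ℚ) : D.du ℚ 0 v = (r : ℚ) • v := by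
  rw [du_eq_mulVecLin, duMatrix_zero, Matrix.mulVecLin_apply, Matrix.smul_mulVec,
    Matrix.one_mulVec]

lemma du_succ_apply (n : ℕ) (v : D.level (n + 1) → ℚ) :
    D.du ℚ (n + 1) v = D.up ℚ n (D.down ℚ n v) + (r : ℚ) • v := by
  rw [du_eq_mulVecLin, duMatrix_succ, Matrix.mulVecLin_apply, Matrix.add_mulVec,
    Matrix.smul_mulVec, Matrix.one_mulVec, ← Matrix.mulVec_mulVec]
  rfl

lemma finrank_level (n : ℕ) : Module.finrank ℚ (D.level n → ℚ) = D.p n :=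
  Module.finrank_fintype_fun_eq_card ℚ

/-- An eigenbasis of `DU_n`, indexed by pairs `(j, s)` where the eigenvalue is `r * j` and `s`
numbers the basis vectors of that eigenspace. -/
theorem exists_eigenbasis (hr : 0 < r) (n : ℕ) :
    ∃ (b : Module.Basis (D.level n) ℚ (D.level n → ℚ)) (j s : D.level n → ℕ),
      (∀ i, D.du ℚ n (b i) = ((r : ℚ) * (j i : ℚ)) • b i) ∧
      (∀ i i', j i = j i' → s i = s i' → i = i') ∧
      ∀ j' s', (∃ i, j i = j' ∧ s i = s') ↔
        j' ∈ Finset.Icc 1 (n + 1) ∧ s' < D.dpN (n + 1 - j') := by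
  induction n with
  | zero =>
    refine ⟨Pi.basisFun ℚ _, fun _ => 1, fun _ => 0, fun i => ?_,
      fun i i' _ _ => Subsingleton.elim _ _, fun j' s' => ?_⟩
    · simp [du_zero_apply]
    · have hp : D.p 0 = 1 := Fintype.card_unique
      simp only [exists_const, zero_add, Finset.Icc_self, Finset.mem_singleton]
      constructor
      · rintro ⟨rfl, rfl⟩
        simp [dpN, hp]
      · rintro ⟨rfl, h⟩
        simp [dpN, hp] at h
        simp [h]
  | succ n ih =>
    obtain ⟨b, j, s, heig, hinj, hmem⟩ := ih
    have hjpos i : (r : ℚ) * (j i : ℚ) ≠ 0 := by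
      have := ((hmem (j i) (s i)).1 ⟨i, rfl, rfl⟩).1
      rw [Finset.mem_Icc] at this
      have h1 : j i ≠ 0 := by omega
      positivity
    have hdu : Function.Surjective (D.du ℚ n) := by
      rw [← LinearMap.range_eq_top, eq_top_iff, ← b.span_eq, Submodule.span_le]
      rintro _ ⟨i, rfl⟩
      exact ⟨((r : ℚ) * (j i : ℚ))⁻¹ • b i, by
        rw [map_smul, heig, smul_smul, inv_mul_cancel₀ (hjpos i), one_smul]⟩
    have hdown : Function.Surjective (D.down ℚ n) := fun v =>
      let ⟨w, hw⟩ := hdu v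
      ⟨D.up ℚ n w, hw⟩
    have hrank := (D.down ℚ n).finrank_range_add_finrank_ker
    rw [LinearMap.range_eq_top.2 hdown, finrank_top, finrank_level, finrank_level] at hrank
    have hker : Module.finrank ℚ (LinearMap.ker (D.down ℚ n)) = D.dpN (n + 1) := by
      rw [dpN]; omega
    let K := Module.finBasisOfFinrankEq ℚ (LinearMap.ker (D.down ℚ n)) hker
    have hcard : Fintype.card (D.level n ⊕ Fin (D.dpN (n + 1))) = D.p (n + 1) := by
      rw [Fintype.card_sum, Fintype.card_fin, ← hrank, hker]; rfl
    let g : D.level n ⊕ Fin (D.dpN (n + 1)) ≃ D.level (n + 1) := Fintype.equivOfCardEq hcard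
    let f : D.level n ⊕ Fin (D.dpN (n + 1)) → D.level (n + 1) → ℚ :=
      Sum.elim (fun i => D.up ℚ n (b i)) (fun t => (K t : D.level (n + 1) → ℚ))
    have hspan : ⊤ ≤ Submodule.span ℚ (Set.range f) := by
      have h1 : LinearMap.range (D.up ℚ n) ≤ Submodule.span ℚ (Set.range f) := by
        rw [LinearMap.range_eq_map, ← b.span_eq, Submodule.map_span, Submodule.span_le]
        rintro _ ⟨_, ⟨i, rfl⟩, rfl⟩
        exact Submodule.subset_span ⟨Sum.inl i, rfl⟩
      have h2 : LinearMap.ker (D.down ℚ n) ≤ Submodule.span ℚ (Set.range f) := by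
        rw [← Submodule.map_subtype_top (LinearMap.ker (D.down ℚ n)), ← K.span_eq,
          Submodule.map_span, Submodule.span_le]
        rintro _ ⟨_, ⟨i, rfl⟩, rfl⟩
        exact Submodule.subset_span ⟨Sum.inr i, rfl⟩
      intro v _
      obtain ⟨w, hw⟩ := hdu (D.down ℚ n v)
      rw [← add_sub_cancel (D.up ℚ n w) v]
      refine add_mem (h1 ⟨w, rfl⟩) (h2 ?_)
      rw [LinearMap.mem_ker, map_sub, ← hw, du, LinearMap.comp_apply, sub_self]
    let B := basisOfTopLeSpanOfCardEqFinrank f hspan (hcard.trans (D.finrank_level _).symm)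
    have hB i : B i = f i := congrFun (coe_basisOfTopLeSpanOfCardEqFinrank f hspan _) i
    refine ⟨B.reindex g, fun i => Sum.elim (fun i => j i + 1) (fun _ => 1) (g.symm i),
      fun i => Sum.elim s (fun t => (t : ℕ)) (g.symm i), ?_, ?_, ?_⟩
    · intro i
      obtain ⟨i, rfl⟩ := g.surjective i
      rw [Module.Basis.reindex_apply, g.symm_apply_apply, hB, du_succ_apply]
      rcases i with i | t
      · have h : D.down ℚ n (D.up ℚ n (b i)) = ((r : ℚ) * (j i : ℚ)) • b i := heig i
        simp only [f, Sum.elim_inl, h, map_smul, ← add_smul]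
        rw [g.symm_apply_apply, Sum.elim_inl]
        push_cast
        ring_nf
      · have h : D.down ℚ n (K t) = 0 := (K t).2
        simp [f, h]
    · intro i i' hj hs
      obtain ⟨i, rfl⟩ := g.surjective i
      obtain ⟨i', rfl⟩ := g.surjective i'
      simp only [g.symm_apply_apply] at hj hs
      have hpos i := (hmem (j i) (s i)).1 ⟨i, rfl, rfl⟩
      simp only [Finset.mem_Icc] at hpos
      rcases i with i | t <;> rcases i' with i' | t' <;>
        simp only [Sum.elim_inl, Sum.elim_inr] at hj hs
      · rw [hinj i i' (by omega) hs]
      · have := (hpos i).1; omega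
      · have := (hpos i').1; omega
      · rw [Fin.ext hs]
    · intro j' s'
      rw [← g.exists_congr_right]
      simp only [g.symm_apply_apply, Sum.exists, Sum.elim_inl, Sum.elim_inr, Finset.mem_Icc]
      constructor
      · rintro (⟨i, rfl, rfl⟩ | ⟨t, rfl, rfl⟩)
        · have h := (hmem (j i) (s i)).1 ⟨i, rfl, rfl⟩
          rw [Finset.mem_Icc] at h
          refine ⟨by omega, ?_⟩
          rw [Nat.add_sub_add_right]
          exact h.2
        · exact ⟨by omega, t.2⟩
      · rintro ⟨h, h'⟩
        obtain rfl | hlt := eq_or_lt_of_le h.1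
        · exact Or.inr ⟨⟨s', h'⟩, rfl, rfl⟩
        · obtain ⟨j', rfl⟩ : ∃ l, j' = l + 1 := ⟨j' - 1, by omega⟩
          rw [Nat.add_sub_add_right] at h'
          obtain ⟨i, hi, hi'⟩ := (hmem j' s').2 ⟨by rw [Finset.mem_Icc]; omega, h'⟩
          exact Or.inl ⟨i, by omega, hi'⟩

end DiffPoset

namespace Module.Basis

variable {ι κ K M : Type*} [Field K] [AddCommGroup M] [Module K M] (b : Basis ι K M)
  {φ : Module.End K M} {c : ι → K}

lemma repr_aeval_apply (hφ : ∀ i, φ (b i) = c i • b i) (p : K[X]) (x : M) (i : ι) :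
    b.repr (aeval φ p x) i = p.eval (c i) * b.repr x i := by
  suffices h : b.coord i ∘ₗ aeval φ p = p.eval (c i) • b.coord i from LinearMap.congr_fun h x
  refine b.ext fun l => ?_
  have hl : aeval φ p (b l) = p.eval (c l) • b l := by
    by_cases hb : b l = 0
    · simp [hb]
    · exact Module.End.aeval_apply_of_hasEigenvector
        ⟨Module.End.mem_eigenspace_iff.2 (hφ l), hb⟩
  by_cases h : l = i
  · subst h; simp [hl]
  · simp [hl, Finsupp.single_eq_of_ne' h]

variable [Fintype ι] [DecidableEq κ] (φ) (s : ι → κ)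

/-- The cyclic `K[X]`-submodule generated by the sum of the basis vectors `b i` with `s i = k`. -/
noncomputable def cyclicFiber (k : κ) : Submodule K[X] (Module.AEval' φ) :=
  Submodule.span K[X] {Module.AEval'.of φ (∑ i with s i = k, b i)}

variable {φ} {s}

lemma repr_smul_sum_fiber (hφ : ∀ i, φ (b i) = c i • b i) (p : K[X]) (k : κ) (i : ι) :
    b.repr (aeval φ p (∑ l with s l = k, b l)) i = if s i = k then p.eval (c i) else 0 := by
  classical
  rw [b.repr_aeval_apply hφ, map_sum, Finset.sum_apply']
  simp [Finsupp.single_apply, Finset.sum_ite_eq']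

lemma annihilator_cyclicFiber (hφ : ∀ i, φ (b i) = c i • b i)
    (hc : ∀ i i', s i = s i' → c i = c i' → i = i') (k : κ) :
    (b.cyclicFiber φ s k).annihilator = Ideal.span {∏ i with s i = k, (X - C (c i))} := by
  ext p
  rw [cyclicFiber, Submodule.mem_annihilator_span_singleton, Ideal.mem_span_singleton]
  change aeval φ p (∑ i with s i = k, b i) = 0 ↔ _
  rw [← b.repr.map_eq_zero_iff, Finsupp.ext_iff]
  simp only [b.repr_smul_sum_fiber hφ, Finsupp.coe_zero, Pi.zero_apply, ite_eq_right_iff]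
  constructor
  · intro h
    refine Finset.prod_dvd_of_coprime (fun i hi i' hi' hne => ?_) fun i hi => ?_
    · simp only [Finset.coe_filter, Finset.mem_univ, true_and, Set.mem_ofPred_eq] at hi hi'
      exact isCoprime_X_sub_C_of_isUnit_sub
        (sub_ne_zero.2 fun h => hne (hc i i' (hi.trans hi'.symm) h)).isUnit
    · exact dvd_iff_isRoot.2 (h i (Finset.mem_filter.1 hi).2)
  · intro h i hi
    exact dvd_iff_isRoot.1 ((Finset.dvd_prod_of_mem (fun i => X - C (c i))
      (Finset.mem_filter.2 ⟨Finset.mem_univ i, hi⟩)).trans h)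

lemma of_mem_cyclicFiber (hφ : ∀ i, φ (b i) = c i • b i)
    (hc : ∀ i i', s i = s i' → c i = c i' → i = i') (i : ι) :
    Module.AEval'.of φ (b i) ∈ b.cyclicFiber φ s (s i) := by
  classical
  rw [cyclicFiber, Submodule.mem_span_singleton]
  refine ⟨Lagrange.interpolate {l | s l = s i} c (Pi.single i 1), ?_⟩
  change aeval φ (Lagrange.interpolate {l | s l = s i} c (Pi.single i 1))
    (∑ l with s l = s i, b l) = b i
  refine b.repr.injective (Finsupp.ext fun l => ?_)
  rw [b.repr_smul_sum_fiber hφ]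
  split_ifs with h
  · rw [Lagrange.eval_interpolate_at_node]
    · simp [Finsupp.single_apply, Pi.single_apply, eq_comm]
    · intro l hl l' hl' hll
      simp only [Finset.coe_filter, Finset.mem_univ, true_and, Set.mem_ofPred_eq] at hl hl'
      exact hc l l' (hl.trans hl'.symm) hll
    · simpa using h
  · have : i ≠ l := fun hil => h (hil ▸ rfl)
    simp [this]

/-- The `K[X]`-submodule of vectors whose coordinates vanish outside of `s ⁻¹' S`. -/
def supportedOn (hφ : ∀ i, φ (b i) = c i • b i) (s : ι → κ) (S : Set κ) :
    Submodule K[X] (Module.AEval' φ) where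
  carrier := {x | ∀ i, s i ∉ S → b.repr ((Module.AEval'.of φ).symm x) i = 0}
  zero_mem' i _ := by simp
  add_mem' hx hy i hi := by simp [hx i hi, hy i hi]
  smul_mem' p x hx i hi := by
    change b.repr (aeval φ p ((Module.AEval'.of φ).symm x)) i = 0
    rw [b.repr_aeval_apply hφ, hx i hi, mul_zero]

lemma cyclicFiber_le_supportedOn (hφ : ∀ i, φ (b i) = c i • b i) {k : κ} {S : Set κ}
    (hk : k ∈ S) : b.cyclicFiber φ s k ≤ b.supportedOn hφ s S := by
  rw [cyclicFiber, Submodule.span_singleton_le_iff_mem]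
  intro i hi
  have h := b.repr_smul_sum_fiber (s := s) hφ 1 k i
  rw [if_neg fun h : s i = k => hi (h ▸ hk), map_one] at h
  exact h

theorem isInternal_cyclicFiber (hφ : ∀ i, φ (b i) = c i • b i)
    (hc : ∀ i i', s i = s i' → c i = c i' → i = i') :
    DirectSum.IsInternal (b.cyclicFiber φ s) := by
  refine DirectSum.isInternal_submodule_of_iSupIndep_of_iSup_eq_top (fun k => ?_) ?_
  · refine Disjoint.mono (b.cyclicFiber_le_supportedOn hφ (Set.mem_singleton k))
      (iSup₂_le fun l hl => b.cyclicFiber_le_supportedOn hφ (S := {k}ᶜ) hl) ?_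
    rw [Submodule.disjoint_def]
    intro x hx hx'
    refine (Module.AEval'.of φ).symm.injective (b.repr.injective (Finsupp.ext fun i => ?_))
    simp only [map_zero, Finsupp.coe_zero, Pi.zero_apply]
    by_cases h : s i ∈ ({k} : Set κ)
    · exact hx' i (by simpa using h)
    · exact hx i h
  · rw [eq_top_iff]
    intro x _
    have hx : x = ∑ i, C (b.repr ((Module.AEval'.of φ).symm x) i) • Module.AEval'.of φ (b i) := by
      refine (Module.AEval'.of φ).symm.injective ?_
      conv_lhs => rw [← b.sum_repr ((Module.AEval'.of φ).symm x)]
      simp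
    rw [hx]
    exact sum_mem fun i _ => Submodule.smul_mem _ _
      (Submodule.mem_iSup_of_mem (s i) (b.of_mem_cyclicFiber hφ hc i))

/-- The characteristic matrix of an endomorphism with an eigenbasis is equivalent to the diagonal
matrix of the characteristic factors of its eigenvalues. -/
lemma exists_isUnit_mul_charmatrix_mul_eq_diagonal {ι K : Type*} [Field K] [Fintype ι]
    [DecidableEq ι] (b : Basis ι K (ι → K)) {N : Matrix ι ι K} {c : ι → K}
    (hN : ∀ i, N.mulVec (b i) = c i • b i) :
    ∃ P Q : Matrix ι ι K[X], IsUnit P ∧ IsUnit Q ∧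
      P * ((X : K[X]) • 1 - N.map C) * Q = Matrix.diagonal fun i => X - C (c i) := by
  let e := Pi.basisFun K ι
  let M := e.toMatrix b
  let M' := b.toMatrix e
  have h1 : M * M' = 1 := e.toMatrix_mul_toMatrix_flip b
  have h2 : M' * M = 1 := b.toMatrix_mul_toMatrix_flip e
  have hNM : N * M = M * Matrix.diagonal c := by
    ext i l
    rw [Matrix.mul_diagonal]
    simpa [M, e, Matrix.mul_apply, Matrix.mulVec, dotProduct, Module.Basis.toMatrix_apply,
      mul_comm] using congrFun (hN l) i
  let F := (C : K →+* K[X]).mapMatrix (m := ι)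
  have h1' : F M * F M' = 1 := by rw [← map_mul, h1, map_one]
  have h2' : F M' * F M = 1 := by rw [← map_mul, h2, map_one]
  refine ⟨F M', F M, ⟨⟨_, _, h2', h1'⟩, rfl⟩, ⟨⟨_, _, h1', h2'⟩, rfl⟩, ?_⟩
  change F M' * ((X : K[X]) • 1 - F N) * F M = _
  rw [mul_sub, sub_mul, mul_assoc _ (F N), ← map_mul, hNM, map_mul, ← mul_assoc, h2', one_mul,
    mul_smul_comm, smul_mul_assoc, mul_one, h2']
  ext i l
  by_cases h : i = l
  · subst h; simp [F]
  · simp [F, h]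

end Module.Basis

namespace Matrix

variable {ι R : Type*} [Fintype ι] [DecidableEq ι] [CommRing R]

/-- Two square matrices are equivalent if they differ by invertible factors on both sides. -/
def IsEquivalent (A B : Matrix ι ι R) : Prop :=
  ∃ P Q : Matrix ι ι R, IsUnit P ∧ IsUnit Q ∧ P * A * Q = B

lemma IsEquivalent.refl (A : Matrix ι ι R) : IsEquivalent A A :=
  ⟨1, 1, isUnit_one, isUnit_one, by simp⟩

lemma IsEquivalent.trans {A B C : Matrix ι ι R} (h : IsEquivalent A B) (h' : IsEquivalent B C) :
    IsEquivalent A C := by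
  obtain ⟨P, Q, hP, hQ, rfl⟩ := h
  obtain ⟨P', Q', hP', hQ', rfl⟩ := h'
  exact ⟨P' * P, Q * Q', hP'.mul hP, hQ.mul hQ', by simp only [mul_assoc]⟩

/-- Two coprime diagonal entries `f`, `g` may be replaced by `1`, `f * g`. -/
lemma isEquivalent_diagonal_update (d : ι → R) {i j : ι} (hij : i ≠ j)
    (h : IsCoprime (d i) (d j)) :
    IsEquivalent (diagonal d)
      (diagonal (Function.update (Function.update d i 1) j (d j * d i))) := by
  obtain ⟨u, v, huv⟩ := h
  have hunit (k l : ι) (hkl : k ≠ l) (t : R) : IsUnit (transvection k l t) := by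
    rw [isUnit_iff_isUnit_det, det_transvection_of_ne _ _ hkl]
    exact isUnit_one
  refine ⟨transvection j i (-1) * (transvection i j (1 - d i) * transvection j i u),
    transvection j i v * transvection i j (d i * d j - d j),
    (hunit _ _ hij.symm _).mul ((hunit _ _ hij _).mul (hunit _ _ hij.symm _)),
    (hunit _ _ hij.symm _).mul (hunit _ _ hij _), ?_⟩
  rw [← mul_assoc, mul_assoc _ _ (diagonal d), mul_assoc _ _ (diagonal d)]
  ext a b
  by_cases hai : a = i <;> by_cases haj : a = j <;> by_cases hbi : b = i <;>
    by_cases hbj : b = j <;> first | (subst_vars; exact absurd rfl hij) | skip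
  all_goals simp only [hij, hij.symm, hai, haj, hbi, hbj, @eq_comm _ i b, @eq_comm _ j b,
    transvection_mul_apply_same, mul_transvection_apply_same, transvection_mul_apply_of_ne,
    mul_transvection_apply_of_ne, ne_eq, not_false_eq_true, diagonal_apply, Function.update_apply,
    if_true, if_false]
  · linear_combination (1 - d i) * huv
  · linear_combination (d i * d j - d j) * (1 - d i) * huv
  · ring
  · linear_combination d i * huv
  · linear_combination (d i * d j - d j) * d i * huv
  all_goals ring

/-- Pairwise coprime diagonal entries in each fibre of an idempotent map `ρ` may be collected
at the fixed point of that fibre. -/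
lemma isEquivalent_diagonal_fiberProd (d : ι → R) (ρ : ι → ι) (hρ : ∀ i, ρ (ρ i) = ρ i)
    (hd : ∀ i j, ρ i = ρ j → i ≠ j → IsCoprime (d i) (d j)) :
    IsEquivalent (diagonal d)
      (diagonal fun i => if ρ i = i then ∏ j with ρ j = i, d j else 1) := by
  suffices h : ∀ T : Finset ι, (∀ i ∈ T, ρ i ≠ i) → IsEquivalent (diagonal d)
      (diagonal fun i => if i ∈ T then 1 else d i * ∏ j ∈ T with ρ j = i, d j) by
    convert h {i | ρ i ≠ i} (by simp) using 3 with i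
    by_cases hi : ρ i = i
    · have hsplit : ({j | ρ j = i} : Finset ι) =
          insert i (({j | ρ j ≠ j} : Finset ι).filter fun j => ρ j = i) := by
        ext j
        by_cases hj : j = i
        · simp [hj, hi]
        · simp only [Finset.mem_filter, Finset.mem_univ, true_and, Finset.mem_insert, hj, false_or]
          exact ⟨fun h => ⟨fun h' => hj (h'.symm.trans h), h⟩, fun h => h.2⟩
      rw [if_pos hi, if_neg (by simp [hi]), hsplit, Finset.prod_insert (by simp [hi])]
    · simp [hi]
  intro T
  induction T using Finset.induction_on with
  | empty => intro _; simpa using IsEquivalent.refl (diagonal d)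
  | insert t T ht ih =>
    intro hT
    have htρ : ρ t ≠ t := hT t (Finset.mem_insert_self t T)
    have hTρ : ∀ i ∈ T, ρ i ≠ i := fun i hi => hT i (Finset.mem_insert_of_mem hi)
    have hρT : ρ t ∉ T := fun h => hTρ _ h (hρ t)
    have hfib i (hi : ρ i ≠ i) : ({j ∈ T | ρ j = i} : Finset ι) = ∅ :=
      Finset.filter_eq_empty_iff.2 fun j _ hj => hi (hj ▸ hρ j)
    refine (ih hTρ).trans ?_
    convert isEquivalent_diagonal_update _ htρ.symm ?_ using 2
    · ext i
      by_cases h1 : i = ρ t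
      · subst h1
        simp [Finset.filter_insert, hρT, htρ, ht, hfib t htρ, Finset.prod_insert]
        ring
      · rw [Function.update_of_ne h1]
        by_cases h2 : i = t
        · simp [h2]
        · simp [h2, Finset.filter_insert, Ne.symm h1]
    · simp only [if_neg ht, if_neg hρT, hfib t htρ, Finset.prod_empty, mul_one]
      refine IsCoprime.mul_right (hd _ _ (hρ t).symm htρ.symm) (IsCoprime.prod_right fun j hj => ?_)
      rw [Finset.mem_filter] at hj
      exact hd _ _ hj.2.symm fun h => ht (h ▸ hj.1)

end Matrix

lemma exists_rank_equiv {ι : Type*} [Fintype ι] {N m : ℕ} (hN : Fintype.card ι = N)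
    {s : ι → ℕ} {g : Fin m → ι} (hg : ∀ k, s (g k) = k) :
    ∃ e : ι ≃ Fin N, (∀ k, (e (g k) : ℕ) = N - 1 - k) ∧
      ∀ i, i ∉ Set.range g → (e i : ℕ) < N - m := by
  classical
  have hginj : Function.Injective g := fun k l h => Fin.ext (by rw [← hg, h, hg])
  have hmN : m ≤ N := by simpa [hN] using Fintype.card_le_of_injective g hginj
  obtain ⟨e, he⟩ := Finset.exists_equiv_extend_of_card_eq (α := ι) (t := Finset.range N)
    (s := Finset.univ.image g) (f := fun i => N - 1 - s i) (by simpa using hN)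
    (by
      intro x hx
      obtain ⟨k, rfl⟩ : ∃ k, N - 1 - s (g k) = x := by simpa using hx
      have := k.2
      rw [Finset.mem_range]
      omega)
    (by
      intro i hi i' hi' h
      obtain ⟨k, rfl⟩ : ∃ k, g k = i := by simpa using hi
      obtain ⟨l, rfl⟩ : ∃ l, g l = i' := by simpa using hi'
      simp only [hg] at h
      have := k.2
      have := l.2
      exact congrArg g (Fin.ext (by omega)))
  have hrep k : (e (g k) : ℕ) = N - 1 - k := by rw [he _ (by simp), hg]
  refine ⟨e.trans ⟨fun x => ⟨x, Finset.mem_range.1 x.2⟩,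
    fun x => ⟨x, Finset.mem_range.2 x.2⟩, fun _ => rfl, fun _ => rfl⟩, hrep, fun i hi => ?_⟩
  by_contra! hlt
  change N - m ≤ (e i : ℕ) at hlt
  have hltN := Finset.mem_range.1 (e i).2
  refine hi ⟨⟨N - 1 - e i, by omega⟩, e.injective (Subtype.ext ?_)⟩
  rw [hrep]
  dsimp only
  omega

/-- For an `r`-differential poset and `n ≥ 0`, with
`m = max{Δp_j : 0 ≤ j ≤ n}` and `a_i(x) = ∏_{1 ≤ j ≤ n+1, Δp_{n+1−j} ≥ m−i+1} (x − rj)`,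
the Smith normal form over `ℚ[x]` of `x·I_{p_n} − [DU_n]` is
`diag(1, ..., 1, a_1(x), ..., a_m(x))`; equivalently, `ℚ^{p_n}` with `x` acting as `DU_n` is a
direct sum of `m` cyclic `ℚ[x]`-submodules with annihilators `(a_1(x)), ..., (a_m(x))`, and
`a_1(x) ∣ a_2(x) ∣ ... ∣ a_m(x)`. -/
theorem snf_of_du_over_rat {r : ℕ} (hr : 0 < r) (D : DiffPoset r) (n : ℕ) :
    let m : ℕ := (Finset.range (n + 1)).sup D.dpN
    let a : ℕ → ℚ[X] := fun i =>
      ∏ j ∈ (Finset.Icc 1 (n + 1)).filter (fun j => m - i + 1 ≤ D.dpN (n + 1 - j)),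
        (X - C ((r : ℚ) * (j : ℚ)))
    let A : Matrix (D.level n) (D.level n) ℚ[X] :=
      (X : ℚ[X]) • 1 - (D.duMatrix ℚ n).map (C : ℚ → ℚ[X])
    let d : Fin (D.p n) → ℚ[X] := fun i =>
      if (i : ℕ) < D.p n - m then 1 else a ((i : ℕ) - (D.p n - m) + 1)
    (∃ (Pm Qm : Matrix (D.level n) (D.level n) ℚ[X]) (e : D.level n ≃ Fin (D.p n)),
      IsUnit Pm ∧ IsUnit Qm ∧ Matrix.reindex e e (Pm * A * Qm) = Matrix.diagonal d) ∧
    (∃ V : Fin m → Submodule ℚ[X] (Module.AEval' (D.du ℚ n)),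
      (∀ i, ∃ v, V i = Submodule.span ℚ[X] {v}) ∧
      (∀ i, (V i).annihilator = Ideal.span {a ((i : ℕ) + 1)}) ∧
      DirectSum.IsInternal V ∧
      (∀ i j : Fin m, i ≤ j → a ((i : ℕ) + 1) ∣ a ((j : ℕ) + 1))) := by
  intro m a A d
  obtain ⟨b, j, s, heig, hinj, hmem⟩ := D.exists_eigenbasis hr n
  have hij i := (hmem (j i) (s i)).1 ⟨i, rfl, rfl⟩
  have hs i : s i < m := (hij i).2.trans_le <|
    Finset.le_sup (f := D.dpN) (Finset.mem_range.2 (by have := Finset.mem_Icc.1 (hij i).1; omega))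
  have hc i i' (hss : s i = s i') (h : (r : ℚ) * (j i : ℚ) = (r : ℚ) * (j i' : ℚ)) : i = i' :=
    hinj i i' (Nat.cast_injective (mul_left_cancel₀ (by positivity) h)) hss
  have hrep (k : Fin m) : ∃ i, s i = k := by
    obtain ⟨l, hl, hkl⟩ := Finset.lt_sup_iff.1 k.2
    rw [Finset.mem_range] at hl
    obtain ⟨i, -, hi⟩ := (hmem (n + 1 - l) k).2
      ⟨Finset.mem_Icc.2 (by omega), by rwa [show n + 1 - (n + 1 - l) = l by omega]⟩
    exact ⟨i, hi⟩
  choose g hg using hrep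
  have hprod (k : ℕ) (hk : k < m) :
      ∏ i with s i = k, (X - C ((r : ℚ) * (j i : ℚ))) = a (m - k) := by
    refine Finset.prod_nbij j ?_ ?_ ?_ fun _ _ => rfl
    · intro i hi
      rw [Finset.mem_filter] at hi ⊢
      exact ⟨(hij i).1, by have := (hij i).2; omega⟩
    · intro i hi i' hi' h
      rw [Finset.mem_coe, Finset.mem_filter] at hi hi'
      exact hinj i i' h (hi.2.trans hi'.2.symm)
    · intro l hl
      rw [Finset.mem_coe, Finset.mem_filter] at hl
      obtain ⟨i, hi, hi'⟩ := (hmem l k).2 ⟨hl.1, by omega⟩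
      exact ⟨i, by simpa using hi', hi⟩
  constructor
  · obtain ⟨P, Q, hP, hQ, hPQ⟩ := b.exists_isUnit_mul_charmatrix_mul_eq_diagonal
      (N := D.duMatrix ℚ n) fun i => by
        rw [← heig i, D.du_eq_mulVecLin, Matrix.mulVecLin_apply]
    let ρ i := g ⟨s i, hs i⟩
    have hsρ i : s (ρ i) = s i := hg _
    have hρ {i i'} (h : s i = s i') : ρ i = ρ i' := by simp only [ρ, h]
    obtain ⟨P', Q', hP', hQ', hPQ'⟩ := Matrix.IsEquivalent.trans ⟨P, Q, hP, hQ, hPQ⟩ <|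
      Matrix.isEquivalent_diagonal_fiberProd _ ρ (fun i => hρ (hsρ i)) fun i i' h hne =>
        isCoprime_X_sub_C_of_isUnit_sub (sub_ne_zero.2 fun hjj =>
          hne (hc i i' (by rw [← hsρ, h, hsρ]) hjj)).isUnit
    obtain ⟨e, he, he'⟩ := exists_rank_equiv (N := D.p n) rfl hg
    refine ⟨P', Q', e, hP', hQ', ?_⟩
    rw [hPQ', Matrix.reindex_apply, Matrix.submatrix_diagonal_equiv]
    congr 1
    ext1 x
    obtain ⟨i, rfl⟩ := e.surjective x
    simp only [Function.comp_apply, e.symm_apply_apply, d]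
    by_cases hi : ρ i = i
    · have hmp : m ≤ D.p n := by
        rw [← Fintype.card_fin m]
        exact Fintype.card_le_of_injective g fun k l h => Fin.ext (by rw [← hg, h, hg])
      have hei : (e i : ℕ) = D.p n - 1 - s i := by
        rw [← hi]; exact (he _).trans (by rw [hsρ])
      have := hs i
      rw [if_pos hi, if_neg (by omega), hei, show D.p n - 1 - s i - (D.p n - m) + 1 = m - s i by
        omega, ← hprod _ (hs i)]
      refine Finset.prod_congr (Finset.filter_congr fun l _ => ?_) fun _ _ => rfl
      exact ⟨fun h => by rw [← hsρ, h], fun h => (hρ h).trans hi⟩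
    · rw [if_neg hi, if_pos]
      refine he' i ?_
      rintro ⟨k, rfl⟩
      exact hi (by simp only [ρ, hg])
  · let σ : D.level n → Fin m := fun i => Fin.rev ⟨s i, hs i⟩
    have hσ i (k : Fin m) : σ i = k ↔ s i = k.rev := by
      rw [Fin.rev_eq_iff, Fin.ext_iff]
    have hcσ i i' (h : σ i = σ i') : _ → i = i' := hc i i' (by
      simpa [σ, Fin.ext_iff] using Fin.rev_injective h)
    refine ⟨b.cyclicFiber (D.du ℚ n) σ, fun k => ⟨_, rfl⟩, fun k => ?_,
      b.isInternal_cyclicFiber heig hcσ, fun i i' h => ?_⟩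
    · rw [b.annihilator_cyclicFiber heig hcσ]
      simp only [hσ]
      rw [hprod _ (Fin.is_lt _), Fin.val_rev, show m - (m - (k + 1)) = k + 1 by omega]
    · refine Finset.prod_dvd_prod_of_subset _ _ _ (Finset.monotone_filter_right _ fun l _ hl => ?_)
      have : (i : ℕ) ≤ i' := h
      omega
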